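/- Theorem (conservation of local equilibrium): fix a continuous γ : ℝ → ℝ≥0 with compact support, t > 0 and x ∈ ℝ. For n ≥ 1, let μ_n be the probability measure on ℕ^ℤ that is the law of the observed particle field η_{⌊tn⌋} of the system of independent Hadamard quantum random walks with initial configuration distributed according to Θ_γ^n (equivalently, by the product-Poisson identity, μ_n = ⊗_{j∈ℤ} Poisson(B(j, ⌊tn⌋)) with B(j, m) := Σ_{k∈ℤ} γ(k/n) p_m(k, j)). Then τ_{⌊xn⌋} μ_n converges weakly, as n → ∞, to ν_{ρ(t,x)}, the product measure on ℕ^ℤ all of whose marginals are Poisson(ρ(t, x)), where ρ(t, x) = (γ * f_t)(x) = ∫_ℝ γ(y)(1/t) f((x−y)/t) dy. -/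

import Mathlib

open MeasureTheory ProbabilityTheory Filter
open scoped NNReal ENNReal Topology

noncomputable section

/-- The state space `ℓ²(ℤ; ℂ²)` of the Hadamard quantum walk. -/
abbrev QWState : Type := lp (fun _ : ℤ => EuclideanSpace ℂ (Fin 2)) 2

/-- The walk started at site `k` with pure coin state `c`
(`c = 0` is the coin `+`, `c = 1` is the coin `−`): the unit vector `δ_k ⊗ c`. -/
def deltaCoin (k : ℤ) (c : Fin 2) : QWState := lp.single 2 k (EuclideanSpace.single c 1)

/-- The Konno density: `f(x) = 1/(π(1−x²)√(1−2x²))` for `|x| < 1/√2`, and `0` otherwise. -/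
def konno (x : ℝ) : ℝ :=
  if |x| < 1 / Real.sqrt 2 then 1 / (Real.pi * (1 - x ^ 2) * Real.sqrt (1 - 2 * x ^ 2)) else 0

/-- The cylinder set of configurations agreeing with `a` on the finite set `F`. -/
def cylinderOf (F : Finset ℤ) (a : ℤ → ℕ) : Set (ℤ → ℕ) := {η | ∀ j ∈ F, η j = a j}

lemma cylinderOf_eq_pi (F : Finset ℤ) (a : ℤ → ℕ) :
    cylinderOf F a = Set.pi (F : Set ℤ) fun j => {a j} := by
  ext η; simp [cylinderOf, Set.mem_pi]

lemma measurableSet_cylinderOf (F : Finset ℤ) (a : ℤ → ℕ) : MeasurableSet (cylinderOf F a) := by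
  rw [cylinderOf_eq_pi]
  exact MeasurableSet.pi F.countable_toSet fun _ _ => MeasurableSet.singleton _

lemma isPiSystem_cylinderOf :
    IsPiSystem {s : Set (ℤ → ℕ) | ∃ F a, s = cylinderOf F a} := by
  rintro _ ⟨F, a, rfl⟩ _ ⟨F', b, rfl⟩ ⟨c, hca, hcb⟩
  refine ⟨F ∪ F', c, ?_⟩
  ext η
  simp only [cylinderOf, Set.mem_inter_iff, Set.mem_ofPred_eq, Finset.mem_union] at hca hcb ⊢
  grind

lemma exists_cylinderOf_subset {u : Set (ℤ → ℕ)} (hu : IsOpen u) {a : ℤ → ℕ} (ha : a ∈ u) :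
    ∃ F : Finset ℤ, cylinderOf F a ∈ 𝓝 a ∧ cylinderOf F a ⊆ u := by
  obtain ⟨F, v, hv, hvu⟩ := isOpen_pi_iff.mp hu a ha
  refine ⟨F, ?_, fun η hη => hvu fun j hj => ?_⟩
  · rw [cylinderOf_eq_pi]
    exact set_pi_mem_nhds F.finite_toSet fun j _ => by simp
  · rw [hη j hj]; exact (hv j hj).2

/-- Weak convergence on `ℕ^ℤ` follows from the convergence of the masses of all cylinders. -/
lemma tendsto_integral_of_tendsto_cylinderOf {μ : ℕ → Measure (ℤ → ℕ)}
    [∀ n, IsProbabilityMeasure (μ n)] {ν : Measure (ℤ → ℕ)} [IsProbabilityMeasure ν]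
    (h : ∀ F a, Tendsto (fun n => μ n (cylinderOf F a)) atTop (𝓝 (ν (cylinderOf F a))))
    (g : BoundedContinuousFunction (ℤ → ℕ) ℝ) :
    Tendsto (fun n => ∫ η, g η ∂(μ n)) atTop (𝓝 (∫ η, g η ∂ν)) := by
  let P : ℕ → ProbabilityMeasure (ℤ → ℕ) := fun n => ⟨μ n, inferInstance⟩
  let Q : ProbabilityMeasure (ℤ → ℕ) := ⟨ν, inferInstance⟩
  have key : Tendsto P atTop (𝓝 Q) := by
    refine isPiSystem_cylinderOf.tendsto_probabilityMeasure_of_tendsto_of_mem ?_ ?_ ?_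
    · rintro _ ⟨F, a, rfl⟩; exact measurableSet_cylinderOf F a
    · intro u hu a ha
      obtain ⟨F, h1, h2⟩ := exists_cylinderOf_subset hu ha
      exact ⟨_, ⟨F, a, rfl⟩, h1, h2⟩
    · rintro _ ⟨F, a, rfl⟩
      exact (ENNReal.tendsto_toNNReal (measure_ne_top ν _)).comp (h F a)
  exact ProbabilityMeasure.tendsto_iff_forall_integral_tendsto.mp key g

lemma measure_cylinderOf_of_map_eq_pi_poisson {μ : Measure (ℤ → ℕ)} {r : ℤ → ℝ≥0} {F : Finset ℤ}
    (h : μ.map (fun η (j : ↥F) => η j.1) = Measure.pi fun j : ↥F => poissonMeasure (r j.1))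
    (a : ℤ → ℕ) :
    μ (cylinderOf F a) = ∏ j ∈ F, poissonMeasure (r j) {a j} := by
  have hm : Measurable (fun (η : ℤ → ℕ) (j : ↥F) => η j.1) := by fun_prop
  have : cylinderOf F a = (fun (η : ℤ → ℕ) (j : ↥F) => η j.1) ⁻¹' {fun j => a j.1} := by
    ext η; simp [cylinderOf, funext_iff]
  rw [this, ← Measure.map_apply hm (MeasurableSet.singleton _), h, Measure.pi_singleton,
    Finset.prod_coe_sort F fun j => poissonMeasure (r j) {a j}]

lemma continuous_poissonMeasure_singleton (k : ℕ) :
    Continuous fun r : ℝ≥0 => poissonMeasure r {k} := by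
  simp_rw [poissonMeasure_singleton]
  exact ENNReal.continuous_ofReal.comp (by fun_prop)

/-- Convergence of the intensities of translated product Poisson measures implies weak
convergence. -/
lemma tendsto_integral_map_shift {μ : ℕ → Measure (ℤ → ℕ)} [∀ n, IsProbabilityMeasure (μ n)]
    {ν : Measure (ℤ → ℕ)} [IsProbabilityMeasure ν] {r : ℕ → ℤ → ℝ≥0} {ρ : ℝ≥0} {s : ℕ → ℤ}
    (hμ : ∀ n, 1 ≤ n → ∀ F : Finset ℤ, (μ n).map (fun η (j : ↥F) => η j.1)
      = Measure.pi fun j : ↥F => poissonMeasure (r n j.1))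
    (hν : ∀ F : Finset ℤ, ν.map (fun η (j : ↥F) => η j.1)
      = Measure.pi fun _ : ↥F => poissonMeasure ρ)
    (hr : ∀ j, Tendsto (fun n => r n (j + s n)) atTop (𝓝 ρ))
    (g : BoundedContinuousFunction (ℤ → ℕ) ℝ) :
    Tendsto (fun n => ∫ η, g η ∂((μ n).map fun η (j : ℤ) => η (j + s n))) atTop
      (𝓝 (∫ η, g η ∂ν)) := by
  have hm : ∀ n, Measurable (fun (η : ℤ → ℕ) (j : ℤ) => η (j + s n)) := fun n => by fun_prop
  have : ∀ n, IsProbabilityMeasure ((μ n).map fun η (j : ℤ) => η (j + s n)) := fun n =>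
    Measure.isProbabilityMeasure_map (hm n).aemeasurable
  refine tendsto_integral_of_tendsto_cylinderOf (fun F a => ?_) g
  rw [measure_cylinderOf_of_map_eq_pi_poisson (r := fun _ => ρ) (hν F)]
  have hlim : Tendsto (fun n => ∏ j ∈ F, poissonMeasure (r n (j + s n)) {a j}) atTop
      (𝓝 (∏ j ∈ F, poissonMeasure ρ {a j})) := by
    refine ENNReal.tendsto_finsetProd_of_ne_top _ (fun j _ => ?_) fun j _ => measure_ne_top _ _
    exact ((continuous_poissonMeasure_singleton (a j)).tendsto ρ).comp (hr j)
  refine hlim.congr' ?_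
  filter_upwards [eventually_ge_atTop 1] with n hn
  rw [Measure.map_apply (hm n) (measurableSet_cylinderOf F a)]
  have hpre : (fun (η : ℤ → ℕ) (j : ℤ) => η (j + s n)) ⁻¹' cylinderOf F a
      = cylinderOf (F.map (addRightEmbedding (s n))) fun j => a (j - s n) := by
    ext η; simp [cylinderOf]
  rw [hpre, measure_cylinderOf_of_map_eq_pi_poisson (hμ n hn _), Finset.prod_map]
  simp

/-- The amplitude of the walk started at the origin with coin state `c`. -/
def walkAmplitude : ℕ → Fin 2 → ℤ → Fin 2 → ℂ
  | 0, c, j, d => if j = 0 ∧ d = c then 1 else 0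
  | m + 1, c, j, d =>
    ![(walkAmplitude m c (j - 1) 0 + walkAmplitude m c (j - 1) 1) / (Real.sqrt 2 : ℂ),
      (walkAmplitude m c (j + 1) 0 - walkAmplitude m c (j + 1) 1) / (Real.sqrt 2 : ℂ)] d

lemma walk_pow_deltaCoin {U : QWState →ₗ[ℂ] QWState}
    (hU : ∀ (ψ : QWState) (k : ℤ),
      (U ψ) k 0 = (ψ (k - 1) 0 + ψ (k - 1) 1) / (Real.sqrt 2 : ℂ) ∧
      (U ψ) k 1 = (ψ (k + 1) 0 - ψ (k + 1) 1) / (Real.sqrt 2 : ℂ))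
    (m : ℕ) (k : ℤ) (c : Fin 2) (j : ℤ) (d : Fin 2) :
    ((U ^ m) (deltaCoin k c)) j d = walkAmplitude m c (j - k) d := by
  induction m generalizing j d with
  | zero =>
    by_cases h : j = k
    · subst h
      simp [deltaCoin, walkAmplitude]
    · simp [deltaCoin, walkAmplitude, sub_eq_zero, h]
  | succ m ih =>
    rw [pow_succ', Module.End.mul_apply]
    fin_cases d
    · simp [(hU _ j).1, ih, walkAmplitude, sub_right_comm]
    · simp [(hU _ j).2, ih, walkAmplitude, sub_add_eq_add_sub]

lemma walkAmplitude_eq_zero {m : ℕ} {j : ℤ} (hj : j ∉ Finset.Icc (-m : ℤ) m) (c d : Fin 2) :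
    walkAmplitude m c j d = 0 := by
  induction m generalizing j d with
  | zero =>
    have : j ≠ 0 := by rintro rfl; simp at hj
    simp [walkAmplitude, this]
  | succ m ih =>
    have h1 : j - 1 ∉ Finset.Icc (-m : ℤ) m := by simp at hj ⊢; omega
    have h2 : j + 1 ∉ Finset.Icc (-m : ℤ) m := by simp at hj ⊢; omega
    fin_cases d <;> simp [walkAmplitude, ih h1, ih h2]

/-- The probability that the walk with uniformly mixed coin is displaced by `j` at time `m`. -/
def walkProb (m : ℕ) (j : ℤ) : ℝ := (1 / 2) * ∑ c, ∑ d, ‖walkAmplitude m c j d‖ ^ 2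

lemma walkProb_nonneg (m : ℕ) (j : ℤ) : 0 ≤ walkProb m j := by
  unfold walkProb; positivity

lemma walkProb_eq_zero {m : ℕ} {j : ℤ} (hj : j ∉ Finset.Icc (-m : ℤ) m) : walkProb m j = 0 := by
  simp [walkProb, walkAmplitude_eq_zero hj]

lemma transition_eq_walkProb {U : QWState →ₗ[ℂ] QWState}
    (hU : ∀ (ψ : QWState) (k : ℤ),
      (U ψ) k 0 = (ψ (k - 1) 0 + ψ (k - 1) 1) / (Real.sqrt 2 : ℂ) ∧
      (U ψ) k 1 = (ψ (k + 1) 0 - ψ (k + 1) 1) / (Real.sqrt 2 : ℂ))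
    (m : ℕ) (k j : ℤ) :
    (1 / 2) * ‖((U ^ m) (deltaCoin k 0)) j‖ ^ 2 + (1 / 2) * ‖((U ^ m) (deltaCoin k 1)) j‖ ^ 2
      = walkProb m (j - k) := by
  simp only [EuclideanSpace.norm_sq_eq, walk_pow_deltaCoin hU, walkProb, Fin.sum_univ_two]
  ring

open Complex Matrix in
/-- The one-step walk operator in Fourier space. -/
def fourierCoin (κ : ℝ) : Matrix (Fin 2) (Fin 2) ℂ :=
  !![exp (κ * I) / (Real.sqrt 2 : ℂ), exp (κ * I) / (Real.sqrt 2 : ℂ);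
    exp (-(κ * I)) / (Real.sqrt 2 : ℂ), -exp (-(κ * I)) / (Real.sqrt 2 : ℂ)]

open Complex in
lemma hasSum_walkAmplitude (m : ℕ) (c d : Fin 2) (κ : ℝ) :
    HasSum (fun j : ℤ => walkAmplitude m c j d * exp (j * κ * I)) ((fourierCoin κ ^ m) d c) := by
  induction m generalizing d with
  | zero =>
    convert! hasSum_ite_eq (0 : ℤ) (if d = c then (1 : ℂ) else 0) using 1
    ext j
    by_cases h : j = 0 <;> simp [walkAmplitude, h]
  | succ m ih =>
    rw [pow_succ', Matrix.mul_apply, Fin.sum_univ_two]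
    fin_cases d
    · have h := (((ih 0).add (ih 1)).mul_left (exp (κ * I) / (Real.sqrt 2 : ℂ)))
      rw [← (Equiv.subRight (1 : ℤ)).hasSum_iff] at h
      convert! h using 1
      · ext j
        have : exp (j * κ * I) = exp (κ * I) * exp ((j - 1 : ℤ) * κ * I) := by
          rw [← exp_add]; push_cast; ring_nf
        simp only [walkAmplitude, this, Function.comp, Equiv.subRight_apply]
        simp; ring
      · simp [fourierCoin]; ring
    · have h := (((ih 0).sub (ih 1)).mul_left (exp (-(κ * I)) / (Real.sqrt 2 : ℂ)))
      rw [← (Equiv.addRight (1 : ℤ)).hasSum_iff] at h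
      convert! h using 1
      · ext j
        have : exp (j * κ * I) = exp (-(κ * I)) * exp ((j + 1 : ℤ) * κ * I) := by
          rw [← exp_add]; push_cast; ring_nf
        simp only [walkAmplitude, this, Function.comp, Equiv.coe_addRight]
        simp; ring
      · simp [fourierCoin]; ring

open Complex in
lemma fourierCoin_pow_apply (m : ℕ) (c d : Fin 2) (κ : ℝ) :
    (fourierCoin κ ^ m) d c
      = ∑ j ∈ Finset.Icc (-m : ℤ) m, walkAmplitude m c j d * exp (j * κ * I) :=
  (hasSum_walkAmplitude m c d κ).unique <| hasSum_sum_of_ne_finset_zero fun j hj => by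
    rw [walkAmplitude_eq_zero hj, zero_mul]

open Complex in
lemma integral_exp_int_mul_I (n : ℤ) :
    ∫ κ : ℝ in (0)..(2 * Real.pi), exp (n * κ * I) = if n = 0 then 2 * Real.pi else 0 := by
  split_ifs with h
  · simp [h]
  · have hn : (n * I : ℂ) ≠ 0 := by simp [h]
    have := integral_exp_mul_complex (a := 0) (b := 2 * Real.pi) hn
    simp_rw [mul_right_comm _ I] at this
    rw [this]
    have : exp (n * (2 * Real.pi : ℝ) * I) = 1 := by
      rw [exp_eq_one_iff]; exact ⟨n, by push_cast; ring⟩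
    rw [this]; simp

open Complex ComplexConjugate in
/-- Parseval's identity for a trigonometric polynomial and its translate. -/
lemma integral_conj_trigPoly_mul (S : Finset ℤ) (a : ℤ → ℂ) (ξ : ℝ) :
    ∫ κ : ℝ in (0)..(2 * Real.pi), conj (∑ j ∈ S, a j * exp (j * κ * I))
        * ∑ j ∈ S, a j * exp (j * (κ + ξ : ℝ) * I)
      = 2 * Real.pi * ∑ j ∈ S, (‖a j‖ ^ 2 : ℝ) * exp (j * ξ * I) := by
  have hexp : ∀ (i j : ℤ) (κ : ℝ), conj (a i * exp (i * κ * I)) * (a j * exp (j * (κ + ξ : ℝ) * I))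
      = (conj (a i) * a j * exp (j * ξ * I)) * exp ((j - i : ℤ) * κ * I) := fun i j κ => by
    have h1 : conj (exp (i * κ * I)) = exp (-(i * κ * I)) := by
      rw [← exp_conj]; simp
    have h2 : exp ((j - i : ℤ) * κ * I) = exp (-(i * κ * I)) * exp (j * κ * I) := by
      rw [← exp_add]; push_cast; ring_nf
    have h3 : exp (j * (κ + ξ : ℝ) * I) = exp (j * κ * I) * exp (j * ξ * I) := by
      rw [← exp_add]; push_cast; ring_nf
    rw [map_mul, h1, h2, h3]; ring
  simp_rw [map_sum, Finset.sum_mul_sum, hexp]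
  rw [intervalIntegral.integral_finsetSum
    (fun i _ => Continuous.intervalIntegrable (by fun_prop) _ _), Finset.mul_sum]
  refine Finset.sum_congr rfl fun i hi => ?_
  rw [intervalIntegral.integral_finsetSum
    (fun j _ => Continuous.intervalIntegrable (by fun_prop) _ _)]
  simp_rw [intervalIntegral.integral_const_mul, integral_exp_int_mul_I, sub_eq_zero]
  rw [Finset.sum_eq_single i (fun j _ hj => by simp [hj]) (fun h => (h hi).elim), if_pos rfl,
    mul_comm (conj _), mul_conj, normSq_eq_norm_sq]
  push_cast; ring

open Complex Matrix in
lemma sum_walkProb_mul_exp (m : ℕ) (ξ : ℝ) :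
    ∑ j ∈ Finset.Icc (-m : ℤ) m, (walkProb m j : ℂ) * exp (j * ξ * I)
      = (4 * Real.pi : ℂ)⁻¹ * ∫ κ : ℝ in (0)..(2 * Real.pi),
        trace ((fourierCoin κ ^ m)ᴴ * fourierCoin (κ + ξ) ^ m) := by
  have htr : ∀ κ : ℝ, trace ((fourierCoin κ ^ m)ᴴ * fourierCoin (κ + ξ) ^ m)
      = ∑ c, ∑ d, (starRingEnd ℂ) ((fourierCoin κ ^ m) d c) * (fourierCoin (κ + ξ) ^ m) d c :=
    fun κ => by simp [trace, Matrix.mul_apply, -conjTranspose_pow]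
  have hint : ∀ c d, IntervalIntegrable (fun κ : ℝ =>
      (starRingEnd ℂ) ((fourierCoin κ ^ m) d c) * (fourierCoin (κ + ξ) ^ m) d c) volume
      0 (2 * Real.pi) := fun c d => by
    simp_rw [fourierCoin_pow_apply]
    exact Continuous.intervalIntegrable (by fun_prop) _ _
  simp_rw [htr]
  rw [intervalIntegral.integral_finsetSum
    fun c _ => by simpa using (hint c 0).add (hint c 1)]
  simp_rw [intervalIntegral.integral_finsetSum fun d _ => hint _ d, fourierCoin_pow_apply,
    integral_conj_trigPoly_mul, ← Finset.mul_sum]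
  have hpi : (Real.pi : ℂ) ≠ 0 := by exact_mod_cast Real.pi_ne_zero
  have : (4 * Real.pi : ℂ)⁻¹ * (2 * Real.pi) = 1 / 2 := by field_simp; norm_num
  rw [← mul_assoc, this]
  simp only [walkProb, Fin.sum_univ_two, ← Finset.sum_add_distrib, Finset.mul_sum]
  refine Finset.sum_congr rfl fun j _ => ?_
  push_cast; ring

/-- The dispersion relation `sin ω = sin κ / √2` of the Hadamard walk. -/
def phase (κ : ℝ) : ℝ := Real.arcsin (Real.sin κ / Real.sqrt 2)

/-- The group velocity, i.e. the derivative of `phase`. -/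
def groupVelocity (κ : ℝ) : ℝ := Real.cos κ / Real.sqrt (1 + Real.cos κ ^ 2)

lemma abs_sin_div_sqrt_two_lt_one (κ : ℝ) : |Real.sin κ / Real.sqrt 2| < 1 := by
  rw [abs_div, abs_of_pos (by positivity : 0 < Real.sqrt 2), div_lt_one (by positivity)]
  exact (Real.abs_sin_le_one κ).trans_lt (by rw [Real.lt_sqrt] <;> norm_num)

lemma sin_phase (κ : ℝ) : Real.sin (phase κ) = Real.sin κ / Real.sqrt 2 :=
  have h := abs_lt.mp (abs_sin_div_sqrt_two_lt_one κ)
  Real.sin_arcsin h.1.le h.2.le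

lemma cos_phase_pos (κ : ℝ) : 0 < Real.cos (phase κ) := by
  have h := abs_lt.mp (abs_sin_div_sqrt_two_lt_one κ)
  exact Real.cos_pos_of_mem_Ioo
    ⟨Real.neg_pi_div_two_lt_arcsin.mpr h.1, Real.arcsin_lt_pi_div_two.mpr h.2⟩

@[fun_prop]
lemma continuous_phase : Continuous phase := by unfold phase; fun_prop

@[fun_prop]
lemma continuous_groupVelocity : Continuous groupVelocity := by
  unfold groupVelocity
  exact Continuous.div (by fun_prop) (by fun_prop) fun κ => by positivity

lemma hasDerivAt_phase (κ : ℝ) : HasDerivAt phase (groupVelocity κ) κ := by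
  have h := abs_lt.mp (abs_sin_div_sqrt_two_lt_one κ)
  convert! (Real.hasDerivAt_arcsin h.1.ne' h.2.ne).comp κ
    ((Real.hasDerivAt_sin κ).div_const (Real.sqrt 2)) using 1
  have h2 : 1 - (Real.sin κ / Real.sqrt 2) ^ 2 = (1 + Real.cos κ ^ 2) / 2 := by
    rw [div_pow, Real.sq_sqrt (by norm_num)]; linarith [Real.sin_sq_add_cos_sq κ]
  rw [h2, Real.sqrt_div (by positivity), groupVelocity]
  field_simp


section Spectral

open Complex Matrix

lemma two_cos_phase (κ : ℝ) :
    (2 * Real.cos (phase κ) : ℂ) = exp (phase κ * I) + exp (-(phase κ * I)) := by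
  rw [ofReal_cos, Complex.cos]; ring_nf

lemma two_cos_phase_ne_zero (κ : ℝ) : (2 * Real.cos (phase κ) : ℂ) ≠ 0 := by
  exact_mod_cast (mul_pos two_pos (cos_phase_pos κ)).ne'

lemma sqrt_two_mul_sin (κ : ℝ) :
    (exp (κ * I) - exp (-(κ * I))) / (Real.sqrt 2 : ℂ)
      = exp (phase κ * I) - exp (-(phase κ * I)) := by
  have h : ∀ y : ℝ, exp (y * I) - exp (-(y * I)) = 2 * I * Real.sin y := fun y => by
    rw [ofReal_sin, Complex.sin]; ring_nf; rw [I_sq]; ring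
  rw [h, h, sin_phase]; push_cast; ring

lemma sqrt_two_mul_self : (Real.sqrt 2 : ℂ) * Real.sqrt 2 = 2 := by
  exact_mod_cast Real.mul_self_sqrt (by norm_num : (0 : ℝ) ≤ 2)

lemma exp_neg_mul_exp (z : ℂ) : exp (-z) * exp z = 1 := by
  rw [← exp_add]; simp

lemma fourierCoin_mul_self (κ : ℝ) :
    fourierCoin κ * fourierCoin κ
      = (exp (phase κ * I) - exp (-(phase κ * I))) • fourierCoin κ + 1 := by
  rw [← sqrt_two_mul_sin]
  have h2 : (Real.sqrt 2 : ℂ) ≠ 0 := by simp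
  have hs := sqrt_two_mul_self
  have he := exp_neg_mul_exp (κ * I)
  ext i j
  fin_cases i <;> fin_cases j <;> simp [fourierCoin, Matrix.mul_apply] <;> field_simp <;>
    grind

lemma fourierCoin_conjTranspose (κ : ℝ) :
    (fourierCoin κ)ᴴ = fourierCoin κ - (exp (phase κ * I) - exp (-(phase κ * I))) • 1 := by
  rw [← sqrt_two_mul_sin]
  have h1 : (starRingEnd ℂ) (exp (κ * I)) = exp (-(κ * I)) := by rw [← exp_conj]; simp
  have h2 : (starRingEnd ℂ) (exp (-(κ * I))) = exp (κ * I) := by rw [← exp_conj]; simp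
  ext i j
  fin_cases i <;> fin_cases j <;> simp [fourierCoin, h1, h2] <;> ring

lemma fourierCoin_mem_unitaryGroup (κ : ℝ) : fourierCoin κ ∈ unitaryGroup (Fin 2) ℂ := by
  rw [mem_unitaryGroup_iff', star_eq_conjTranspose, fourierCoin_conjTranspose, sub_mul,
    fourierCoin_mul_self]
  simp

/-- The spectral projection of `fourierCoin κ` onto the eigenvalue `exp (i ω)`. -/
def spectralProj (κ : ℝ) : Matrix (Fin 2) (Fin 2) ℂ :=
  (2 * Real.cos (phase κ) : ℂ)⁻¹ • (fourierCoin κ + exp (-(phase κ * I)) • 1)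

lemma fourierCoin_mul_spectralProj (κ : ℝ) :
    fourierCoin κ * spectralProj κ = exp (phase κ * I) • spectralProj κ := by
  have h : fourierCoin κ * (fourierCoin κ + exp (-(phase κ * I)) • 1)
      = exp (phase κ * I) • (fourierCoin κ + exp (-(phase κ * I)) • 1) := by
    rw [mul_add, fourierCoin_mul_self, smul_add, smul_smul, mul_comm (exp (phase κ * I)),
      exp_neg_mul_exp, mul_smul_comm, mul_one]
    module
  rw [spectralProj, mul_smul_comm, h, smul_comm]

lemma fourierCoin_mul_one_sub_spectralProj (κ : ℝ) :
    fourierCoin κ * (1 - spectralProj κ) = (-exp (-(phase κ * I))) • (1 - spectralProj κ) := by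
  have h : fourierCoin κ
      = (2 * Real.cos (phase κ) : ℂ) • spectralProj κ - exp (-(phase κ * I)) • 1 := by
    rw [spectralProj, smul_smul, mul_inv_cancel₀ (two_cos_phase_ne_zero κ)]; simp
  rw [mul_sub, fourierCoin_mul_spectralProj, mul_one, h, two_cos_phase]
  module

lemma spectralProj_mul_self (κ : ℝ) : spectralProj κ * spectralProj κ = spectralProj κ := by
  conv_lhs => enter [1]; rw [spectralProj]
  rw [smul_mul_assoc, add_mul, fourierCoin_mul_spectralProj, smul_mul_assoc, one_mul, ← add_smul,
    ← two_cos_phase, smul_smul, inv_mul_cancel₀ (two_cos_phase_ne_zero κ), one_smul]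

lemma spectralProj_conjTranspose (κ : ℝ) : (spectralProj κ)ᴴ = spectralProj κ := by
  have h1 : (starRingEnd ℂ) (exp (-(phase κ * I))) = exp (phase κ * I) := by
    rw [← exp_conj]; simp
  rw [spectralProj, conjTranspose_smul, conjTranspose_add, fourierCoin_conjTranspose,
    conjTranspose_smul, conjTranspose_one]
  simp only [star_def, map_inv₀, map_mul, conj_ofReal, map_ofNat, h1]
  congr 1
  module

lemma trace_spectralProj (κ : ℝ) : trace (spectralProj κ) = 1 := by
  have h : trace (fourierCoin κ) = exp (phase κ * I) - exp (-(phase κ * I)) := by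
    rw [← sqrt_two_mul_sin]; simp [trace_fin_two, fourierCoin]; ring
  rw [spectralProj, trace_smul, trace_add, h, trace_smul, trace_one, smul_eq_mul]
  rw [inv_mul_eq_one₀ (two_cos_phase_ne_zero κ), two_cos_phase]
  simp; ring

lemma fourierCoin_pow (κ : ℝ) (m : ℕ) :
    fourierCoin κ ^ m = exp (phase κ * I) ^ m • spectralProj κ
      + (-exp (-(phase κ * I))) ^ m • (1 - spectralProj κ) := by
  induction m with
  | zero => simp
  | succ m ih =>
    rw [pow_succ', ih, mul_add, mul_smul_comm, mul_smul_comm, fourierCoin_mul_spectralProj,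
      fourierCoin_mul_one_sub_spectralProj, smul_smul, smul_smul, pow_succ, pow_succ]

@[fun_prop]
lemma continuous_fourierCoin : Continuous fourierCoin := by
  unfold fourierCoin
  refine continuous_matrix fun i j => ?_
  fin_cases i <;> fin_cases j <;> simp <;> fun_prop

@[fun_prop]
lemma continuous_spectralProj : Continuous spectralProj := by
  unfold spectralProj
  refine Continuous.smul (Continuous.inv₀ (by fun_prop) two_cos_phase_ne_zero) (by fun_prop)

lemma tendsto_zero_of_tendsto_natCast_mul {ε : ℕ → ℝ} {m : ℕ → ℕ} {s : ℝ}
    (hm : Tendsto m atTop atTop) (hε : Tendsto (fun n => m n * ε n) atTop (𝓝 s)) :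
    Tendsto ε atTop (𝓝 0) := by
  have hm' : Tendsto (fun n => (m n : ℝ)) atTop atTop := tendsto_natCast_atTop_atTop.comp hm
  refine (hε.div_atTop hm').congr' ?_
  filter_upwards [hm'.eventually_gt_atTop 0] with n hn
  field_simp

lemma tendsto_mul_phase_sub {ε : ℕ → ℝ} {m : ℕ → ℕ} {s : ℝ} (hm : Tendsto m atTop atTop)
    (hε : Tendsto (fun n => m n * ε n) atTop (𝓝 s)) (κ : ℝ) :
    Tendsto (fun n => m n * (phase (κ + ε n) - phase κ)) atTop (𝓝 (s * groupVelocity κ)) := by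
  have hε0 := tendsto_zero_of_tendsto_natCast_mul hm hε
  simpa [smul_eq_mul] using (hasDerivAt_phase κ).hasFDerivAt.hasFDerivWithinAt (s := Set.univ)
    |>.lim hε0 (by simp) (c := fun n => (m n : ℝ)) hε

lemma norm_trace_conjTranspose_pow_mul_le (m : ℕ) (κ κ' : ℝ) :
    ‖trace ((fourierCoin κ ^ m)ᴴ * fourierCoin κ' ^ m)‖ ≤ 2 := by
  have h : (fourierCoin κ ^ m)ᴴ * fourierCoin κ' ^ m ∈ unitaryGroup (Fin 2) ℂ :=
    mul_mem (Unitary.star_mem (pow_mem (fourierCoin_mem_unitaryGroup κ) m))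
      (pow_mem (fourierCoin_mem_unitaryGroup κ') m)
  rw [trace_fin_two]
  refine (norm_add_le _ _).trans ?_
  linarith [entry_norm_bound_of_unitary h 0 0, entry_norm_bound_of_unitary h 1 1]

lemma trace_conjTranspose_pow_mul (m : ℕ) (κ κ' : ℝ) :
    trace ((fourierCoin κ ^ m)ᴴ * fourierCoin κ' ^ m)
      = exp (m * (phase κ' - phase κ) * I) * trace (spectralProj κ * spectralProj κ')
        + exp (-(phase κ * I)) ^ m * (-exp (-(phase κ' * I))) ^ m
          * trace (spectralProj κ * (1 - spectralProj κ'))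
        + (-exp (phase κ * I)) ^ m * exp (phase κ' * I) ^ m
          * trace ((1 - spectralProj κ) * spectralProj κ')
        + exp (-(m * (phase κ' - phase κ) * I))
          * trace ((1 - spectralProj κ) * (1 - spectralProj κ')) := by
  have h1 : (starRingEnd ℂ) (exp (-(phase κ * I))) = exp (phase κ * I) := by
    rw [← exp_conj]; simp
  have h2 : (starRingEnd ℂ) (exp (phase κ * I)) = exp (-(phase κ * I)) := by
    rw [← exp_conj]; simp
  have h3 : exp (m * (phase κ' - phase κ) * I)
      = exp (-(phase κ * I)) ^ m * exp (phase κ' * I) ^ m := by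
    rw [← mul_pow, ← exp_add, ← exp_nat_mul]; ring_nf
  have h4 : exp (-(m * (phase κ' - phase κ) * I))
      = (-exp (phase κ * I)) ^ m * (-exp (-(phase κ' * I))) ^ m := by
    rw [← mul_pow, neg_mul_neg, ← exp_add, ← exp_nat_mul]; ring_nf
  rw [fourierCoin_pow, fourierCoin_pow, conjTranspose_add, conjTranspose_smul, conjTranspose_smul,
    conjTranspose_sub, conjTranspose_one, spectralProj_conjTranspose, h3, h4]
  simp only [star_def, map_pow, map_neg, h1, h2, add_mul, mul_add, smul_mul_smul_comm, trace_add,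
    trace_smul, smul_eq_mul]
  ring

lemma norm_exp_neg_ofReal_mul_I (y : ℝ) : ‖exp (-(y * I))‖ = 1 := by
  rw [← neg_mul, ← ofReal_neg, norm_exp_ofReal_mul_I]

/-- Pointwise ballistic asymptotics of the walk in Fourier space. -/
lemma tendsto_trace_fourierCoin {ε : ℕ → ℝ} {m : ℕ → ℕ} {s : ℝ} (hm : Tendsto m atTop atTop)
    (hε : Tendsto (fun n => m n * ε n) atTop (𝓝 s)) (κ : ℝ) :
    Tendsto (fun n => trace ((fourierCoin κ ^ m n)ᴴ * fourierCoin (κ + ε n) ^ m n)) atTop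
      (𝓝 (exp (s * groupVelocity κ * I) + exp (-(s * groupVelocity κ * I)))) := by
  have hκ : Tendsto (fun n => κ + ε n) atTop (𝓝 κ) := by
    simpa using (tendsto_zero_of_tendsto_natCast_mul hm hε).const_add κ
  have hph : Tendsto (fun n => (m n * (phase (κ + ε n) - phase κ) : ℂ)) atTop
      (𝓝 (s * groupVelocity κ)) := by
    have := (continuous_ofReal.tendsto _).comp (tendsto_mul_phase_sub hm hε κ)
    simpa [Function.comp_def] using this
  have htr : ∀ {f : ℝ → Matrix (Fin 2) (Fin 2) ℂ}, Continuous f →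
      Tendsto (fun n => trace (f (κ + ε n))) atTop (𝓝 (trace (f κ))) := fun {f} hf =>
    ((Continuous.matrix_trace hf).tendsto κ).comp hκ
  have t1 := htr (f := fun κ' => spectralProj κ * spectralProj κ') (by fun_prop)
  have t2 := htr (f := fun κ' => spectralProj κ * (1 - spectralProj κ')) (by fun_prop)
  have t3 := htr (f := fun κ' => (1 - spectralProj κ) * spectralProj κ') (by fun_prop)
  have t4 := htr (f := fun κ' => (1 - spectralProj κ) * (1 - spectralProj κ')) (by fun_prop)
  simp only [mul_sub, sub_mul, mul_one, one_mul, spectralProj_mul_self, sub_self, trace_zero,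
    sub_zero, trace_sub, trace_spectralProj, trace_one, Fintype.card_fin] at t1 t2 t3 t4
  simp_rw [trace_conjTranspose_pow_mul]
  have b2 := t2.zero_mul_isBoundedUnder_le (g := fun n =>
      exp (-(phase κ * I)) ^ m n * (-exp (-(phase (κ + ε n) * I))) ^ m n) <|
    isBoundedUnder_of ⟨1, fun n => by simp [norm_exp_neg_ofReal_mul_I]⟩
  have b3 := t3.zero_mul_isBoundedUnder_le (g := fun n =>
      (-exp (phase κ * I)) ^ m n * exp (phase (κ + ε n) * I) ^ m n) <|
    isBoundedUnder_of ⟨1, fun n => by simp [norm_exp_ofReal_mul_I]⟩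
  have e1 := ((hph.mul_const I).cexp).mul t1
  have e4 := ((hph.mul_const I).neg.cexp).mul t4
  convert! ((e1.add b2).add b3).add e4 using 2
  · simp only [mul_sub, sub_mul, mul_one, one_mul, trace_sub, trace_spectralProj, trace_one,
      Fintype.card_fin]
    ring
  · push_cast; ring

/-- The characteristic function of the walk at ballistic scale. -/
lemma tendsto_sum_walkProb_mul_exp {ε : ℕ → ℝ} {m : ℕ → ℕ} {s : ℝ} (hm : Tendsto m atTop atTop)
    (hε : Tendsto (fun n => m n * ε n) atTop (𝓝 s)) :
    Tendsto (fun n => ∑ j ∈ Finset.Icc (-m n : ℤ) (m n), (walkProb (m n) j : ℂ)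
        * exp (j * ε n * I)) atTop
      (𝓝 ((2 * Real.pi : ℂ)⁻¹ * ∫ κ : ℝ in (0)..(2 * Real.pi), exp (s * groupVelocity κ * I))) := by
  have hper : ∀ κ, groupVelocity (κ + Real.pi) = -groupVelocity κ := fun κ => by
    simp [groupVelocity, neg_div]
  have hflip : ∫ κ : ℝ in (0)..(2 * Real.pi), exp (-(s * groupVelocity κ * I))
      = ∫ κ : ℝ in (0)..(2 * Real.pi), exp (s * groupVelocity κ * I) := by
    have hp : Function.Periodic (fun κ : ℝ => exp (s * groupVelocity κ * I)) (2 * Real.pi) := by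
      intro κ
      simp [groupVelocity]
    have h1 := hp.intervalIntegral_add_eq Real.pi 0
    have h2 := intervalIntegral.integral_comp_add_right (a := 0) (b := 2 * Real.pi)
      (fun κ : ℝ => exp (s * groupVelocity κ * I)) Real.pi
    rw [zero_add, add_comm, h1, zero_add] at h2
    simp only [hper, ofReal_neg, mul_neg, neg_mul] at h2
    exact h2
  have hlim : Tendsto (fun n => ∫ κ : ℝ in (0)..(2 * Real.pi),
      trace ((fourierCoin κ ^ m n)ᴴ * fourierCoin (κ + ε n) ^ m n)) atTop
      (𝓝 (∫ κ : ℝ in (0)..(2 * Real.pi),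
        (exp (s * groupVelocity κ * I) + exp (-(s * groupVelocity κ * I))))) := by
    refine intervalIntegral.tendsto_integral_filter_of_dominated_convergence (fun _ => 2)
      (.of_forall fun n => Continuous.aestronglyMeasurable ?_)
      (.of_forall fun n => .of_forall fun κ _ => norm_trace_conjTranspose_pow_mul_le _ _ _)
      intervalIntegrable_const (.of_forall fun κ _ => tendsto_trace_fourierCoin hm hε κ)
    exact Continuous.matrix_trace (by fun_prop)
  simp_rw [sum_walkProb_mul_exp]
  rw [intervalIntegral.integral_add (Continuous.intervalIntegrable (by fun_prop) _ _)
    (Continuous.intervalIntegrable (by fun_prop) _ _), hflip] at hlim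
  rw [← two_mul] at hlim
  convert! hlim.const_mul (4 * Real.pi : ℂ)⁻¹ using 2
  rw [← mul_assoc]
  congr 1
  field_simp; norm_num

lemma sum_walkProb (m : ℕ) : ∑ j ∈ Finset.Icc (-m : ℤ) m, walkProb m j = 1 := by
  have h := sum_walkProb_mul_exp m 0
  have hU : ∀ κ, (fourierCoin κ ^ m)ᴴ * fourierCoin κ ^ m = 1 := fun κ =>
    mem_unitaryGroup_iff'.mp (pow_mem (fourierCoin_mem_unitaryGroup κ) m)
  simp only [ofReal_zero, mul_zero, zero_mul, exp_zero, mul_one, add_zero, hU, trace_one] at h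
  have hpi : (Real.pi : ℂ) ≠ 0 := by exact_mod_cast Real.pi_ne_zero
  have h1 : (4 * Real.pi : ℂ)⁻¹ * (2 * Real.pi * 2) = 1 := by field_simp; norm_num
  simp only [Fintype.card_fin, Nat.cast_ofNat, intervalIntegral.integral_const, sub_zero,
    real_smul, ofReal_mul, ofReal_ofNat, h1] at h
  exact_mod_cast h

end Spectral

lemma abs_lt_one_div_sqrt_two_iff (u : ℝ) : |u| < 1 / Real.sqrt 2 ↔ u ^ 2 < 1 / 2 := by
  rw [← Real.sqrt_sq_eq_abs, ← Real.sqrt_one, ← Real.sqrt_div zero_le_one,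
    Real.sqrt_lt_sqrt_iff (sq_nonneg u), Real.sqrt_one]

lemma groupVelocity_sq (κ : ℝ) :
    groupVelocity κ ^ 2 = Real.cos κ ^ 2 / (1 + Real.cos κ ^ 2) := by
  rw [groupVelocity, div_pow, Real.sq_sqrt (by positivity)]

lemma one_sub_groupVelocity_sq (κ : ℝ) :
    1 - groupVelocity κ ^ 2 = 1 / (1 + Real.cos κ ^ 2) := by
  rw [groupVelocity_sq]; field_simp; ring

lemma one_sub_two_mul_groupVelocity_sq (κ : ℝ) :
    1 - 2 * groupVelocity κ ^ 2 = Real.sin κ ^ 2 / (1 + Real.cos κ ^ 2) := by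
  rw [groupVelocity_sq, Real.sin_sq]; field_simp; ring

lemma cos_eq_of_groupVelocity (κ : ℝ) :
    Real.cos κ = groupVelocity κ / Real.sqrt (1 - groupVelocity κ ^ 2) := by
  rw [one_sub_groupVelocity_sq, Real.sqrt_div zero_le_one, Real.sqrt_one, groupVelocity]
  field_simp

lemma injOn_groupVelocity : Set.InjOn groupVelocity (Set.Ioo 0 Real.pi) := by
  intro κ hκ κ' hκ' h
  refine Real.injOn_cos (Set.Ioo_subset_Icc_self hκ) (Set.Ioo_subset_Icc_self hκ') ?_
  rw [cos_eq_of_groupVelocity, h, ← cos_eq_of_groupVelocity]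

lemma image_groupVelocity :
    groupVelocity '' Set.Ioo 0 Real.pi = {u | |u| < 1 / Real.sqrt 2} := by
  ext u
  simp only [Set.mem_image, Set.mem_ofPred_eq, abs_lt_one_div_sqrt_two_iff]
  constructor
  · rintro ⟨κ, hκ, rfl⟩
    have h := one_sub_two_mul_groupVelocity_sq κ
    have : 0 < Real.sin κ ^ 2 / (1 + Real.cos κ ^ 2) := by
      have := Real.sin_pos_of_mem_Ioo hκ
      positivity
    linarith
  · intro hu
    have hpos : 0 < 1 - u ^ 2 := by linarith
    set c := u / Real.sqrt (1 - u ^ 2) with hc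
    have hc2 : c ^ 2 = u ^ 2 / (1 - u ^ 2) := by rw [hc, div_pow, Real.sq_sqrt hpos.le]
    have hc1 : |c| < 1 := by
      rw [← sq_lt_one_iff_abs_lt_one, hc2, div_lt_one hpos]; linarith
    obtain ⟨h1, h2⟩ := abs_lt.mp hc1
    refine ⟨Real.arccos c, ⟨Real.arccos_pos.mpr h2, Real.arccos_lt_pi.mpr h1⟩, ?_⟩
    have h3 : 1 + c ^ 2 = 1 / (1 - u ^ 2) := by rw [hc2]; field_simp; ring
    rw [groupVelocity, Real.cos_arccos h1.le h2.le, h3, Real.sqrt_div zero_le_one, Real.sqrt_one,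
      hc]
    field_simp

lemma hasDerivAt_groupVelocity (κ : ℝ) :
    HasDerivAt groupVelocity
      (-Real.sin κ / ((1 + Real.cos κ ^ 2) * Real.sqrt (1 + Real.cos κ ^ 2))) κ := by
  have hpos : 0 < 1 + Real.cos κ ^ 2 := by positivity
  have hsq := Real.sq_sqrt hpos.le
  convert! (Real.hasDerivAt_cos κ).div
    ((((Real.hasDerivAt_cos κ).pow 2).const_add 1).sqrt hpos.ne') (by positivity) using 1
  simp only [Pi.pow_apply]
  rw [hsq]
  field_simp
  rw [hsq]
  push_cast
  ring

lemma abs_deriv_groupVelocity_mul_konno {κ : ℝ} (hκ : κ ∈ Set.Ioo 0 Real.pi) :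
    |-Real.sin κ / ((1 + Real.cos κ ^ 2) * Real.sqrt (1 + Real.cos κ ^ 2))|
      * konno (groupVelocity κ) = 1 / Real.pi := by
  have hsin := Real.sin_pos_of_mem_Ioo hκ
  have hlt : |groupVelocity κ| < 1 / Real.sqrt 2 := by
    have : groupVelocity κ ∈ {u | |u| < 1 / Real.sqrt 2} :=
      image_groupVelocity ▸ Set.mem_image_of_mem _ hκ
    exact this
  have hpos : 0 < 1 + Real.cos κ ^ 2 := by positivity
  rw [konno, if_pos hlt, one_sub_groupVelocity_sq, one_sub_two_mul_groupVelocity_sq,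
    Real.sqrt_div (sq_nonneg _), Real.sqrt_sq hsin.le, abs_div, abs_neg, abs_of_pos hsin,
    abs_of_pos (by positivity)]
  field_simp

/-- The Konno density is the law of the group velocity at a uniform random wave number. -/
lemma integral_comp_groupVelocity {g : ℝ → ℝ} (hg : Continuous g) :
    ∫ κ in (0)..(2 * Real.pi), g (groupVelocity κ) = 2 * Real.pi * ∫ u, g u * konno u := by
  have hsymm : ∫ κ in Real.pi..(2 * Real.pi), g (groupVelocity κ)
      = ∫ κ in (0)..Real.pi, g (groupVelocity κ) := by
    have h := intervalIntegral.integral_comp_sub_left (a := 0) (b := Real.pi)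
      (fun κ => g (groupVelocity κ)) (2 * Real.pi)
    have h2 : ∀ κ, groupVelocity (2 * Real.pi - κ) = groupVelocity κ := fun κ => by
      simp [groupVelocity, Real.cos_two_pi_sub]
    simp only [h2, sub_zero] at h
    rw [h]; congr 1; ring
  have hhalf : ∫ u, g u * konno u = Real.pi⁻¹ * ∫ κ in (0)..Real.pi, g (groupVelocity κ) := by
    have hsupp : ∫ u in groupVelocity '' Set.Ioo 0 Real.pi, g u * konno u
        = ∫ u, g u * konno u := by
      refine setIntegral_eq_integral_of_forall_compl_eq_zero fun u hu => ?_
      rw [image_groupVelocity, Set.mem_ofPred_eq] at hu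
      rw [konno, if_neg hu, mul_zero]
    rw [← hsupp, integral_image_eq_integral_abs_deriv_smul measurableSet_Ioo
      (fun κ _ => (hasDerivAt_groupVelocity κ).hasDerivWithinAt) injOn_groupVelocity,
      intervalIntegral.integral_of_le Real.pi_pos.le, integral_Ioc_eq_integral_Ioo,
      ← integral_const_mul]
    refine setIntegral_congr_fun measurableSet_Ioo fun κ hκ => ?_
    have h := abs_deriv_groupVelocity_mul_konno hκ
    simp only [smul_eq_mul]
    rw [mul_left_comm, h]; ring
  have hint : ∀ a b, IntervalIntegrable (fun κ => g (groupVelocity κ)) volume a b := fun a b =>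
    Continuous.intervalIntegrable (by fun_prop) a b
  rw [← intervalIntegral.integral_add_adjacent_intervals (hint 0 Real.pi) (hint _ _), hsymm, hhalf]
  field_simp
  ring

lemma integral_mul_rescaled_konno (γ : ℝ → ℝ) {t : ℝ} (ht : 0 < t) (x : ℝ) :
    ∫ y, γ y * ((1 / t) * konno ((x - y) / t)) = ∫ u, γ (x - t * u) * konno u := by
  have h : ∀ y, γ y * ((1 / t) * konno ((x - y) / t))
      = t⁻¹ * (γ (x - t * ((x - y) / t)) * konno ((x - y) / t)) := fun y => by
    rw [mul_div_cancel₀ _ ht.ne', sub_sub_cancel]; ring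
  simp_rw [h]
  rw [integral_const_mul,
    integral_sub_left_eq_self (fun y => γ (x - t * (y / t)) * konno (y / t)) volume x,
    Measure.integral_comp_div (fun u => γ (x - t * u) * konno u), abs_of_pos ht, smul_eq_mul,
    inv_mul_cancel_left₀ ht.ne']

/-- The law of the starting point, rescaled by `n`, of a walk observed at site `J` at time `m`. -/
def originLaw (n m : ℕ) (J : ℤ) : Measure ℝ :=
  ∑ j ∈ Finset.Icc (-m : ℤ) m,
    ENNReal.ofReal (walkProb m j) • Measure.dirac (((J - j : ℤ) : ℝ) / n)

instance (n m : ℕ) (J : ℤ) : IsProbabilityMeasure (originLaw n m J) := by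
  constructor
  simp only [originLaw, Measure.coe_finsetSum, Finset.sum_apply, Measure.smul_apply, measure_univ,
    smul_eq_mul, mul_one]
  rw [← ENNReal.ofReal_sum_of_nonneg fun j _ => walkProb_nonneg m j, sum_walkProb,
    ENNReal.ofReal_one]

lemma integral_originLaw {E : Type*} [NormedAddCommGroup E] [NormedSpace ℝ E] [CompleteSpace E]
    (f : ℝ → E) (n m : ℕ) (J : ℤ) :
    ∫ y, f y ∂(originLaw n m J)
      = ∑ j ∈ Finset.Icc (-m : ℤ) m, walkProb m j • f (((J - j : ℤ) : ℝ) / n) := by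
  rw [originLaw, integral_finsetSum_measure fun j _ =>
    (integrable_dirac (by simp)).smul_measure ENNReal.ofReal_ne_top]
  simp [integral_smul_measure, ENNReal.toReal_ofReal (walkProb_nonneg m _)]

lemma integral_originLaw_eq_tsum (γ : ℝ → ℝ) (n m : ℕ) (J : ℤ) :
    ∫ y, γ y ∂(originLaw n m J) = ∑' k : ℤ, γ ((k : ℝ) / n) * walkProb m (J - k) := by
  rw [integral_originLaw, ← (Equiv.subLeft J).tsum_eq, tsum_eq_sum
    (s := Finset.Icc (-m : ℤ) m) fun j hj => by simp [walkProb_eq_zero hj]]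
  simp [mul_comm]

/-- The limit law of the rescaled starting point. -/
def limitOriginLaw (t x : ℝ) : Measure ℝ :=
  (ENNReal.ofReal (2 * Real.pi)⁻¹ • volume.restrict (Set.Ioc 0 (2 * Real.pi))).map
    fun κ => x - t * groupVelocity κ

instance (t x : ℝ) : IsProbabilityMeasure (limitOriginLaw t x) := by
  have : IsProbabilityMeasure
      (ENNReal.ofReal (2 * Real.pi)⁻¹ • volume.restrict (Set.Ioc 0 (2 * Real.pi))) := by
    constructor
    rw [Measure.smul_apply, Measure.restrict_apply_univ, Real.volume_Ioc, sub_zero, smul_eq_mul,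
      ← ENNReal.ofReal_mul (by positivity), inv_mul_cancel₀ (by positivity), ENNReal.ofReal_one]
  exact Measure.isProbabilityMeasure_map (by fun_prop)

lemma integral_limitOriginLaw {E : Type*} [NormedAddCommGroup E] [NormedSpace ℝ E]
    [SecondCountableTopology E] {f : ℝ → E} (hf : Continuous f) (t x : ℝ) :
    ∫ y, f y ∂(limitOriginLaw t x)
      = (2 * Real.pi)⁻¹ • ∫ κ in (0)..(2 * Real.pi), f (x - t * groupVelocity κ) := by
  rw [limitOriginLaw, integral_map (by fun_prop) hf.aestronglyMeasurable, integral_smul_measure,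
    ENNReal.toReal_ofReal (by positivity), intervalIntegral.integral_of_le (by positivity)]

open Complex in
lemma tendsto_originLaw {t x : ℝ} (ht : 0 < t) {J : ℕ → ℤ}
    (hJ : Tendsto (fun n => (J n : ℝ) / n) atTop (𝓝 x)) :
    Tendsto (β := ProbabilityMeasure ℝ)
      (fun n => ⟨originLaw n ⌊t * n⌋₊ (J n), inferInstance⟩) atTop
      (𝓝 ⟨limitOriginLaw t x, inferInstance⟩) := by
  refine ProbabilityMeasure.tendsto_of_tendsto_charFun fun θ => ?_
  simp only [ProbabilityMeasure.coe_mk, charFun_apply_real]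
  rw [integral_limitOriginLaw (by fun_prop)]
  simp_rw [integral_originLaw]
  have hm : Tendsto (fun n : ℕ => ⌊t * n⌋₊) atTop atTop :=
    tendsto_nat_floor_atTop.comp (tendsto_natCast_atTop_atTop.const_mul_atTop ht)
  have hε : Tendsto (fun n : ℕ => (⌊t * n⌋₊ : ℝ) * (-θ / n)) atTop (𝓝 (-(t * θ))) := by
    have h := ((tendsto_nat_floor_mul_div_atTop ht.le).comp
      tendsto_natCast_atTop_atTop).mul_const (-θ)
    convert! h using 2
    · simp only [Function.comp]; ring
    · ring
  have hexp : Tendsto (fun n : ℕ => exp (θ * ((J n : ℝ) / n : ℝ) * I)) atTop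
      (𝓝 (exp (θ * x * I))) :=
    ((((continuous_ofReal.tendsto x).comp hJ).const_mul _).mul_const I).cexp
  convert! hexp.mul (tendsto_sum_walkProb_mul_exp hm hε) using 2 with n
  · rw [Finset.mul_sum]
    refine Finset.sum_congr rfl fun j _ => ?_
    rw [real_smul, mul_left_comm, ← exp_add]
    push_cast
    ring_nf
  · simp only [real_smul]
    rw [mul_left_comm]
    congr 1
    · push_cast
      rfl
    rw [← intervalIntegral.integral_const_mul]
    refine intervalIntegral.integral_congr fun κ _ => ?_
    simp only [← exp_add]
    push_cast
    ring_nf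

/-- Convergence of the intensities to the solution of the macroscopic equation. -/
lemma tendsto_tsum_walkProb {γ : ℝ → ℝ} (hγ : Continuous γ) (hγs : HasCompactSupport γ)
    {t x : ℝ} (ht : 0 < t) {J : ℕ → ℤ} (hJ : Tendsto (fun n => (J n : ℝ) / n) atTop (𝓝 x)) :
    Tendsto (fun n : ℕ => ∑' k : ℤ, γ ((k : ℝ) / n) * walkProb ⌊t * n⌋₊ (J n - k)) atTop
      (𝓝 (∫ y, γ y * ((1 / t) * konno ((x - y) / t)))) := by
  obtain ⟨C, hC⟩ := hγ.bounded_above_of_compact_support hγs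
  have h := ProbabilityMeasure.tendsto_iff_forall_integral_tendsto.mp (tendsto_originLaw ht hJ)
    (BoundedContinuousFunction.ofNormedAddCommGroup γ hγ C hC)
  simp only [BoundedContinuousFunction.coe_ofNormedAddCommGroup, ProbabilityMeasure.coe_mk] at h
  rw [integral_limitOriginLaw hγ,
    integral_comp_groupVelocity (g := fun u => γ (x - t * u)) (by fun_prop), smul_eq_mul,
    inv_mul_cancel_left₀ (by positivity)] at h
  simpa only [integral_originLaw_eq_tsum, integral_mul_rescaled_konno γ ht x] using h

lemma tendsto_add_floor_div (j : ℤ) (x : ℝ) :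
    Tendsto (fun n : ℕ => ((j + ⌊x * n⌋ : ℤ) : ℝ) / n) atTop (𝓝 x) := by
  have h1 : Tendsto (fun n : ℕ => (j : ℝ) / n) atTop (𝓝 0) :=
    tendsto_const_div_atTop_nhds_zero_nat _
  have h2 : Tendsto (fun n : ℕ => Int.fract (x * n) / n) atTop (𝓝 0) := by
    refine squeeze_zero (fun n => div_nonneg (Int.fract_nonneg _) n.cast_nonneg) (fun n => ?_)
      tendsto_one_div_atTop_nhds_zero_nat
    gcongr
    exact (Int.fract_lt_one _).le
  have h3 : Tendsto (fun n : ℕ => (j : ℝ) / n + (x - Int.fract (x * n) / n)) atTop (𝓝 x) := by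
    simpa using h1.add (h2.const_sub x)
  refine h3.congr' ?_
  filter_upwards [eventually_ge_atTop 1] with n hn
  have hn0 : (n : ℝ) ≠ 0 := by positivity
  rw [Int.fract]
  push_cast
  field_simp
  ring

/-- **Conservation of local equilibrium.**
Fix a continuous nonnegative `γ : ℝ → ℝ` with compact support, `t > 0` and `x ∈ ℝ`.
For `n ≥ 1` let `μ_n` be the law on `ℕ^ℤ` of the observed particle field `η_{⌊tn⌋}` of
the system of independent Hadamard quantum random walks started from `Θ_γ^n`;
equivalently (product-Poisson identity), `μ_n = ⊗_j Poisson(B(j,⌊tn⌋))` with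
`B(j,m) = Σ_k γ(k/n) p_m(k,j)`, `p_m(k,j) = ½‖(U^m(δ_k⊗+))(j)‖² + ½‖(U^m(δ_k⊗−))(j)‖²`
(the product measures on `ℕ^ℤ` are characterized through their finite-dimensional
marginals). Then the translated laws `τ_{⌊xn⌋}μ_n` converge weakly to `ν_{ρ(t,x)}`, the
product measure with all marginals Poisson(`ρ(t,x)`), where
`ρ(t,x) = (γ * f_t)(x) = ∫ γ(y)(1/t)f((x−y)/t) dy` and `f` is the Konno density. -/
theorem conservation_of_local_equilibrium
    (U : QWState →ₗ[ℂ] QWState)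
    (hU : ∀ (ψ : QWState) (k : ℤ),
      (U ψ) k 0 = (ψ (k - 1) 0 + ψ (k - 1) 1) / (Real.sqrt 2 : ℂ) ∧
      (U ψ) k 1 = (ψ (k + 1) 0 - ψ (k + 1) 1) / (Real.sqrt 2 : ℂ))
    (p : ℕ → ℤ → ℤ → ℝ)
    (hp : ∀ (m : ℕ) (k j : ℤ), p m k j =
      (1 / 2) * ‖((U ^ m) (deltaCoin k 0)) j‖ ^ 2
        + (1 / 2) * ‖((U ^ m) (deltaCoin k 1)) j‖ ^ 2)
    (γ : ℝ → ℝ) (hγcont : Continuous γ) (hγnonneg : ∀ y, 0 ≤ γ y)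
    (hγsupp : HasCompactSupport γ)
    (t : ℝ) (ht : 0 < t) (x : ℝ)
    (μ : ℕ → Measure (ℤ → ℕ)) (hμprob : ∀ n, IsProbabilityMeasure (μ n))
    (hμ : ∀ (n : ℕ), 1 ≤ n → ∀ (F : Finset ℤ),
      (μ n).map (fun η (j : ↥F) => η j.1)
        = Measure.pi (fun j : ↥F => poissonMeasure (Real.toNNReal
            (∑' k : ℤ, γ ((k : ℝ) / (n : ℝ)) * p ⌊t * (n : ℝ)⌋₊ k j.1))))
    (ν : Measure (ℤ → ℕ)) (hνprob : IsProbabilityMeasure ν)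
    (hν : ∀ F : Finset ℤ,
      ν.map (fun η (j : ↥F) => η j.1)
        = Measure.pi (fun _ : ↥F => poissonMeasure (Real.toNNReal
            (∫ y : ℝ, γ y * ((1 / t) * konno ((x - y) / t)))))) :
    ∀ g : BoundedContinuousFunction (ℤ → ℕ) ℝ,
      Tendsto
        (fun n : ℕ =>
          ∫ η, g η ∂((μ n).map (fun η (j : ℤ) => η (j + ⌊x * (n : ℝ)⌋))))
        atTop (𝓝 (∫ η, g η ∂ν)) := by
  intro g
  refine tendsto_integral_map_shift
    (r := fun n j => Real.toNNReal (∑' k : ℤ, γ ((k : ℝ) / n) * p ⌊t * (n : ℝ)⌋₊ k j))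
    hμ hν (fun j => ?_) g
  have hq : ∀ m k j, p m k j = walkProb m (j - k) := fun m k j => by
    rw [hp, transition_eq_walkProb hU]
  simp only [hq]
  exact (continuous_real_toNNReal.tendsto _).comp
    (tendsto_tsum_walkProb hγcont hγsupp ht (tendsto_add_floor_div j x))

end
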